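/- Let K₁ = ⟨V, M⟩, K₂ = ⟨V, C, E, T⟩, K = ⟨K₁, K₂⟩, G₁ = ⟨A, M, S, Σ⟩, G₂ = ⟨Q, S, E, T, Σ⟩ and G = ⟨G₁, G₂⟩. Then: (i) G₁ = F K₁ (SΣ) with [F, K₁] = 1, F ∩ K₁ = 1 and (F K₁) ∩ ⟨S,Σ⟩ = 1; (ii) G₂ = K₂ F (SΣ) with [F, K₂] = Z, F ∩ K₂ = 1 and (K₂ F) ∩ ⟨S,Σ⟩ = 1; (iii) G₁ ∩ G₂ = F (K₁ ∩ K₂) ⟨S,Σ⟩; (iv) K is a normal subgroup of G and G = K F ⟨S,Σ⟩. -/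

import Mathlib

open Equiv

/-! Context: `q = 3^r`, `K = F_q` a finite field with `3^r` elements, `Ω = K × K × K`,
`ε = 3^(r-1)` (so `q = 3ε`).  Permutations of `Ω` are composed left to right in the paper;
in Lean, `(g * h) x = g (h x)`, so the paper's product `g·h` corresponds to `h * g` here,
and the paper's conjugate `g⁻¹ x g` corresponds to `g * x * g⁻¹`. -/

/-- The permutation `α_{(u,v,w)} : (a,b,c) ↦ (a+u, b+v, c+w)` of `Ω = K × K × K`. -/
def alphaPerm {K : Type*} [Field K] (u v w : K) : Equiv.Perm (K × K × K) where
  toFun x := (x.1 + u, x.2.1 + v, x.2.2 + w)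
  invFun x := (x.1 - u, x.2.1 - v, x.2.2 - w)
  left_inv x := by simp
  right_inv x := by simp

/-- The permutation `β_{λ,μ} : (a,b,c) ↦ (λa, μb, (λμ)^{2ε} c)` of `Ω = K × K × K`. -/
def betaPerm {K : Type*} [Field K] (ε : ℕ) (l m : Kˣ) : Equiv.Perm (K × K × K) where
  toFun x := ((l : K) * x.1, (m : K) * x.2.1, (((l * m) ^ (2 * ε) : Kˣ) : K) * x.2.2)
  invFun x := ((l⁻¹ : Kˣ) * x.1, (m⁻¹ : Kˣ) * x.2.1, ((((l * m) ^ (2 * ε))⁻¹ : Kˣ) : K) * x.2.2)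
  left_inv x := by simp
  right_inv x := by simp

/-- The permutation `γ_e : (a,b,c) ↦ (a+eb, b, c)` of `Ω = K × K × K`. -/
def gammaPerm {K : Type*} [Field K] (e : K) : Equiv.Perm (K × K × K) where
  toFun x := (x.1 + e * x.2.1, x.2.1, x.2.2)
  invFun x := (x.1 - e * x.2.1, x.2.1, x.2.2)
  left_inv x := by simp
  right_inv x := by simp

/-- The permutation `δ : (a,b,c) ↦ (b, -a, c)` of `Ω = K × K × K`. -/
def deltaPerm (K : Type*) [Field K] : Equiv.Perm (K × K × K) where
  toFun x := (x.2.1, -x.1, x.2.2)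
  invFun x := (-x.2.1, x.1, x.2.2)
  left_inv x := by simp
  right_inv x := by simp

/-- The permutation `τ_d : (a,b,c) ↦ (a + d·b² + d^ε·c, b, c)` of `Ω = K × K × K`. -/
def tauPerm {K : Type*} [Field K] (ε : ℕ) (d : K) : Equiv.Perm (K × K × K) where
  toFun x := (x.1 + d * x.2.1 ^ 2 + d ^ ε * x.2.2, x.2.1, x.2.2)
  invFun x := (x.1 - d * x.2.1 ^ 2 - d ^ ε * x.2.2, x.2.1, x.2.2)
  left_inv x := by obtain ⟨a, b, c⟩ := x; simp; ring
  right_inv x := by obtain ⟨a, b, c⟩ := x; simp; ring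

/-- The cube map `x ↦ x³` as a permutation of a finite field of characteristic 3. -/
noncomputable def frobPerm (K : Type*) [Field K] [Fintype K] [CharP K 3] : Equiv.Perm K :=
  Equiv.ofBijective (fun x => x ^ 3)
    (Finite.injective_iff_bijective.mp (by
      intro x y h
      exact frobenius_inj K 3 (by simpa [frobenius_def] using h)))

/-- The permutation `σ : (a,b,c) ↦ (a³, b³, c³)` of `Ω = K × K × K`. -/
noncomputable def sigmaPerm (K : Type*) [Field K] [Fintype K] [CharP K 3] :
    Equiv.Perm (K × K × K) :=
  (frobPerm K).prodCongr ((frobPerm K).prodCongr (frobPerm K))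

variable (K : Type*) [Field K]

/-- `A = ⟨α_{(u,v,w)} : u,v,w ∈ F_q⟩`. -/
def Agrp : Subgroup (Equiv.Perm (K × K × K)) :=
  Subgroup.closure {g | ∃ u v w : K, g = alphaPerm u v w}

/-- `V = ⟨α_{(u,v,0)} : u,v ∈ F_q⟩`. -/
def Vgrp : Subgroup (Equiv.Perm (K × K × K)) :=
  Subgroup.closure {g | ∃ u v : K, g = alphaPerm u v 0}

/-- `F = ⟨α_{(0,0,w)} : w ∈ F_q⟩`. -/
def Fgrp : Subgroup (Equiv.Perm (K × K × K)) :=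
  Subgroup.closure {g | ∃ w : K, g = alphaPerm 0 0 w}

/-- `Z₀ = ⟨α_{(u,0,w)} : u,w ∈ F_q⟩`. -/
def Z0grp : Subgroup (Equiv.Perm (K × K × K)) :=
  Subgroup.closure {g | ∃ u w : K, g = alphaPerm u 0 w}

/-- `Z = ⟨α_{(u,0,0)} : u ∈ F_q⟩`. -/
def Zgrp : Subgroup (Equiv.Perm (K × K × K)) :=
  Subgroup.closure {g | ∃ u : K, g = alphaPerm u 0 0}

/-- `C = ⟨γ_e : e ∈ F_q⟩`. -/
def Cgrp : Subgroup (Equiv.Perm (K × K × K)) :=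
  Subgroup.closure {g | ∃ e : K, g = gammaPerm e}

/-- `R = ⟨β_{μ,μ} : μ ∈ F_q^×⟩`. -/
def Rgrp (ε : ℕ) : Subgroup (Equiv.Perm (K × K × K)) :=
  Subgroup.closure {g | ∃ μ : Kˣ, g = betaPerm ε μ μ}

/-- `S = ⟨β_{μ²,μ} : μ ∈ F_q^×⟩`. -/
def Sgrp (ε : ℕ) : Subgroup (Equiv.Perm (K × K × K)) :=
  Subgroup.closure {g | ∃ μ : Kˣ, g = betaPerm ε (μ ^ 2) μ}

/-- `T = ⟨β_{μ,μ⁻¹} : μ ∈ F_q^×⟩`. -/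
def Tgrp (ε : ℕ) : Subgroup (Equiv.Perm (K × K × K)) :=
  Subgroup.closure {g | ∃ μ : Kˣ, g = betaPerm ε μ μ⁻¹}

/-- `D = ⟨δ⟩`. -/
def Dgrp : Subgroup (Equiv.Perm (K × K × K)) :=
  Subgroup.closure {deltaPerm K}

/-- `E = ⟨τ_d : d ∈ F_q⟩`. -/
def Egrp (ε : ℕ) : Subgroup (Equiv.Perm (K × K × K)) :=
  Subgroup.closure {g | ∃ d : K, g = tauPerm ε d}

/-- `M = ⟨C, D, T⟩`. -/
def Mgrp (ε : ℕ) : Subgroup (Equiv.Perm (K × K × K)) :=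
  Cgrp K ⊔ Dgrp K ⊔ Tgrp K ε

/-- `Q = ⟨A, C⟩`. -/
def QgrpBig : Subgroup (Equiv.Perm (K × K × K)) :=
  Agrp K ⊔ Cgrp K

/-- `P = ⟨Q, E⟩`. -/
def Pgrp (ε : ℕ) : Subgroup (Equiv.Perm (K × K × K)) :=
  QgrpBig K ⊔ Egrp K ε

/-- `Σ = ⟨σ⟩`. -/
noncomputable def Siggrp (K : Type*) [Field K] [Fintype K] [CharP K 3] :
    Subgroup (Equiv.Perm (K × K × K)) :=
  Subgroup.closure {sigmaPerm K}

/-- `K₁ = ⟨V, M⟩`. -/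
def K1grp (K : Type*) [Field K] (ε : ℕ) : Subgroup (Equiv.Perm (K × K × K)) :=
  Vgrp K ⊔ Mgrp K ε

/-- `K₂ = ⟨V, C, E, T⟩`. -/
def K2grp (K : Type*) [Field K] (ε : ℕ) : Subgroup (Equiv.Perm (K × K × K)) :=
  Vgrp K ⊔ Cgrp K ⊔ Egrp K ε ⊔ Tgrp K ε

/-- `G₁ = ⟨A, M, S, Σ⟩`. -/
noncomputable def G1grp (K : Type*) [Field K] [Fintype K] [CharP K 3] (ε : ℕ) :
    Subgroup (Equiv.Perm (K × K × K)) :=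
  Agrp K ⊔ Mgrp K ε ⊔ Sgrp K ε ⊔ Siggrp K

/-- `G₂ = ⟨Q, S, E, T, Σ⟩`. -/
noncomputable def G2grp (K : Type*) [Field K] [Fintype K] [CharP K 3] (ε : ℕ) :
    Subgroup (Equiv.Perm (K × K × K)) :=
  QgrpBig K ⊔ Sgrp K ε ⊔ Egrp K ε ⊔ Tgrp K ε ⊔ Siggrp K

/-- `G₁₂ = ⟨Q, S, T, Σ⟩`. -/
noncomputable def G12grp (K : Type*) [Field K] [Fintype K] [CharP K 3] (ε : ℕ) :
    Subgroup (Equiv.Perm (K × K × K)) :=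
  QgrpBig K ⊔ Sgrp K ε ⊔ Tgrp K ε ⊔ Siggrp K

section helpers

/-- A multiplicatively closed set containing 1 in a finite group, as a subgroup. -/
def finSub {G : Type*} [Group G] [Finite G] (P : G → Prop) (h1 : P 1)
    (hm : ∀ x y, P x → P y → P (x * y)) : Subgroup G where
  carrier := {g | P g}
  one_mem' := h1
  mul_mem' := fun {a b} ha hb => hm a b ha hb
  inv_mem' := by
    intro x hx
    have hpow : ∀ n : ℕ, P (x ^ n) := by
      intro n
      induction n with
      | zero => simpa using h1
      | succ k ih => rw [pow_succ]; exact hm _ _ ih hx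
    have h := hpow (orderOf x - 1)
    have : x⁻¹ = x ^ (orderOf x - 1) := by
      rw [inv_eq_iff_mul_eq_one, ← pow_succ', Nat.sub_add_cancel (orderOf_pos x), pow_orderOf_eq_one]
    show P x⁻¹
    rw [this]; exact h

theorem conj_closure_le {G : Type*} [Group G] {s : Set G} {N : Subgroup G} {g : G}
    (h : ∀ x ∈ s, ∃ y ∈ N, g * x = y * g) :
    Subgroup.closure s ≤ N.comap (MulAut.conj g).toMonoidHom := by
  rw [Subgroup.closure_le]
  intro x hx
  obtain ⟨y, hy, e⟩ := h x hx
  show g * x * g⁻¹ ∈ N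
  rw [e]; simpa using hy

theorem mem_normalizer_of_le {G : Type*} [Group G] [Finite G] {N : Subgroup G} {g : G}
    (h : N ≤ N.comap (MulAut.conj g).toMonoidHom) : g ∈ Subgroup.normalizer (N : Set G) := by
  have h' : ∀ x ∈ N, g * x * g⁻¹ ∈ N := fun x hx => h hx
  have hp : g ∈ finSub (fun g : G => ∀ x ∈ N, g * x * g⁻¹ ∈ N) (by simp)
      (by
        intro a b ha hb x hx
        have := ha _ (hb x hx)
        simpa [mul_assoc] using this) := h'
  have hi : ∀ x ∈ N, g⁻¹ * x * g⁻¹⁻¹ ∈ N := inv_mem hp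
  rw [Subgroup.mem_normalizer_iff]
  intro x
  refine ⟨h' x, fun hx => ?_⟩
  have := hi _ hx
  simpa [mul_assoc] using this

theorem exists_of_norm {G : Type*} [Group G] {H N : Subgroup G}
    (h : H ≤ Subgroup.normalizer (N : Set G)) {g : G} (hg : g ∈ H ⊔ N) :
    ∃ x ∈ H, ∃ y ∈ N, g = x * y := by
  have : g ∈ ((H ⊔ N : Subgroup G) : Set G) := hg
  rw [Subgroup.coe_mul_of_left_le_normalizer_right _ _ h] at this
  obtain ⟨x, hx, y, hy, e⟩ := this
  exact ⟨x, hx, y, hy, e.symm⟩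

theorem norm_sup {G : Type*} [Group G] {H N M : Subgroup G}
    (h : H ≤ Subgroup.normalizer (N : Set G)) (h' : H ≤ Subgroup.normalizer (M : Set G)) :
    H ≤ Subgroup.normalizer ((N ⊔ M : Subgroup G) : Set G) := by
  intro g hg
  have key : ∀ g ∈ H, ∀ x ∈ N ⊔ M, g * x * g⁻¹ ∈ N ⊔ M := by
    intro g hg
    have : N ⊔ M ≤ (N ⊔ M).comap (MulAut.conj g).toMonoidHom := by
      refine sup_le (fun x hx => ?_) (fun x hx => ?_)
      · exact Subgroup.mem_sup_left ((Subgroup.mem_normalizer_iff.1 (h hg) x).1 hx)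
      · exact Subgroup.mem_sup_right ((Subgroup.mem_normalizer_iff.1 (h' hg) x).1 hx)
    exact fun x hx => this hx
  rw [Subgroup.mem_normalizer_iff]
  intro x
  refine ⟨key g hg x, fun hx => ?_⟩
  have := key _ (inv_mem hg) _ hx
  simpa [mul_assoc] using this

variable {K : Type*} [Field K]

theorem al_mul (u v w u' v' w' : K) :
    alphaPerm u v w * alphaPerm u' v' w' = alphaPerm (u + u') (v + v') (w + w') := by
  ext x <;> simp [alphaPerm] <;> ring

theorem be_al (ε : ℕ) (l m : Kˣ) (u v w : K) : betaPerm ε l m * alphaPerm u v w =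
    alphaPerm (l * u) (m * v) ((((l * m) ^ (2 * ε) : Kˣ) : K) * w) * betaPerm ε l m := by
  ext x <;> simp [alphaPerm, betaPerm] <;> ring

theorem be_ga (ε : ℕ) (l m : Kˣ) (e : K) : betaPerm ε l m * gammaPerm e =
    gammaPerm (l * e * (m⁻¹ : Kˣ)) * betaPerm ε l m := by
  ext x
  · simp [gammaPerm, betaPerm]; field_simp
  · simp [gammaPerm, betaPerm]
  · simp [gammaPerm, betaPerm]

theorem be_de (ε : ℕ) (l m : Kˣ) : betaPerm ε l m * deltaPerm K =
    deltaPerm K * betaPerm ε (m * l⁻¹) (m * l⁻¹)⁻¹ * betaPerm ε l m := by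
  ext x
  · simp [deltaPerm, betaPerm]; field_simp
  · simp [deltaPerm, betaPerm]; field_simp
  · simp [deltaPerm, betaPerm]

theorem be_be (ε : ℕ) (l m l' m' : Kˣ) : betaPerm ε l m * betaPerm ε l' m' =
    betaPerm ε l' m' * betaPerm ε l m := by
  ext x <;> simp [betaPerm] <;> ring

theorem be_ta (ε : ℕ) (hq : ∀ x : K, x ^ (3 * ε) = x) (l m : Kˣ) (d : K) :
    betaPerm ε l m * tauPerm ε d =
    tauPerm ε (l * d * ((m⁻¹ : Kˣ) : K) ^ 2) * betaPerm ε l m := by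
  ext x
  · have h1 : (l : K) = ((l : K) ^ ε) ^ 3 := by rw [← pow_mul, mul_comm ε 3, hq]
    have h2 : ((m⁻¹ : Kˣ) : K) ^ ε * (m : K) ^ ε = 1 := by
      rw [← mul_pow]; simp
    have h3 : ((m⁻¹ : Kˣ) : K) * (m : K) = 1 := by simp
    simp only [tauPerm, betaPerm, Perm.mul_apply, Equiv.coe_fn_mk]
    push_cast [mul_pow, pow_mul']
    push_cast at h2 h3
    have e1 : (l : K) * d * ((m : K)⁻¹) ^ 2 * ((m:K) ^ 2 * x.2.1 ^ 2) = l * (d * x.2.1 ^ 2) := by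
      linear_combination (l * d * x.2.1^2 * ((m : K)⁻¹ * m + 1)) * h3
    have e2 : (l : K) ^ ε * d ^ ε * (((m : K)⁻¹) ^ ε) ^ 2 *
        (((l : K) ^ ε) ^ 2 * ((m : K) ^ ε) ^ 2 * x.2.2) = l * (d ^ ε * x.2.2) := by
      linear_combination (((l : K) ^ ε) ^ 3 * d ^ ε * x.2.2 * (((m : K)⁻¹) ^ ε * (m : K) ^ ε + 1)) * h2
        - (d ^ ε * x.2.2) * h1
    rw [e1, pow_right_comm ((m : K)⁻¹) 2 ε, e2]; ring
  · simp [tauPerm, betaPerm]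
  · simp [tauPerm, betaPerm]

theorem al_ga (w e : K) : alphaPerm 0 0 w * gammaPerm e = gammaPerm e * alphaPerm 0 0 w := by
  ext x <;> simp [alphaPerm, gammaPerm]

theorem al_de (w : K) : alphaPerm 0 0 w * deltaPerm K = deltaPerm K * alphaPerm 0 0 w := by
  ext x <;> simp [alphaPerm, deltaPerm]

theorem al_be (ε : ℕ) (w : K) (m : Kˣ) : alphaPerm 0 0 w * betaPerm ε m m⁻¹ =
    betaPerm ε m m⁻¹ * alphaPerm 0 0 w := by
  ext x <;> simp [alphaPerm, betaPerm]

theorem al_al (w u v : K) : alphaPerm 0 0 w * alphaPerm u v 0 =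
    alphaPerm u v 0 * alphaPerm 0 0 w := by
  ext x <;> simp [alphaPerm]

theorem al_ta (ε : ℕ) (w d : K) : alphaPerm 0 0 w * tauPerm ε d =
    alphaPerm (-(d ^ ε * w)) 0 0 * tauPerm ε d * alphaPerm 0 0 w := by
  ext x <;> simp [alphaPerm, tauPerm] <;> ring

section fin
variable [Fintype K] [CharP K 3]

theorem si_apply (x : K × K × K) : sigmaPerm K x = (x.1 ^ 3, x.2.1 ^ 3, x.2.2 ^ 3) := rfl

theorem cube_add (x y : K) : (x + y) ^ 3 = x ^ 3 + y ^ 3 := by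
  have := add_pow_char x y 3
  exact this

theorem si_al (u v w : K) : sigmaPerm K * alphaPerm u v w =
    alphaPerm (u ^ 3) (v ^ 3) (w ^ 3) * sigmaPerm K := by
  ext x <;> simp [alphaPerm, si_apply, cube_add]

theorem si_ga (e : K) : sigmaPerm K * gammaPerm e = gammaPerm (e ^ 3) * sigmaPerm K := by
  ext x <;> simp [gammaPerm, si_apply, cube_add, mul_pow]

theorem si_de : sigmaPerm K * deltaPerm K = deltaPerm K * sigmaPerm K := by
  ext x
  · simp [deltaPerm, si_apply]
  · simp [deltaPerm, si_apply]; ring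
  · simp [deltaPerm, si_apply]

theorem si_be (ε : ℕ) (l m : Kˣ) : sigmaPerm K * betaPerm ε l m =
    betaPerm ε (l ^ 3) (m ^ 3) * sigmaPerm K := by
  ext x <;> simp [betaPerm, si_apply] <;> ring

theorem si_ta (ε : ℕ) (d : K) : sigmaPerm K * tauPerm ε d =
    tauPerm ε (d ^ 3) * sigmaPerm K := by
  ext x
  · simp [tauPerm, si_apply, cube_add]; ring
  · simp [tauPerm, si_apply]
  · simp [tauPerm, si_apply]

end fin

theorem al_mem_V (u v : K) : alphaPerm u v 0 ∈ Vgrp K := Subgroup.subset_closure ⟨u, v, rfl⟩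
theorem al_mem_F (w : K) : alphaPerm 0 0 w ∈ Fgrp K := Subgroup.subset_closure ⟨w, rfl⟩
theorem al_mem_Z (u : K) : alphaPerm u 0 0 ∈ Zgrp K := Subgroup.subset_closure ⟨u, rfl⟩
theorem ga_mem (e : K) : gammaPerm e ∈ Cgrp K := Subgroup.subset_closure ⟨e, rfl⟩
theorem de_mem : deltaPerm K ∈ Dgrp K := Subgroup.subset_closure rfl
theorem ta_mem (ε : ℕ) (d : K) : tauPerm ε d ∈ Egrp K ε := Subgroup.subset_closure ⟨d, rfl⟩
theorem be_mem_T (ε : ℕ) (m : Kˣ) : betaPerm ε m m⁻¹ ∈ Tgrp K ε :=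
  Subgroup.subset_closure ⟨m, rfl⟩

theorem A_eq : Agrp K = Vgrp K ⊔ Fgrp K := by
  apply le_antisymm
  · refine (Subgroup.closure_le _).2 ?_
    rintro _ ⟨u, v, w, rfl⟩
    have : alphaPerm u v w = alphaPerm u v 0 * alphaPerm 0 0 w := by simp [al_mul]
    rw [this]
    exact mul_mem (Subgroup.mem_sup_left (al_mem_V u v)) (Subgroup.mem_sup_right (al_mem_F w))
  · refine sup_le ((Subgroup.closure_le _).2 ?_) ((Subgroup.closure_le _).2 ?_)
    · rintro _ ⟨u, v, rfl⟩
      exact Subgroup.subset_closure ⟨u, v, 0, rfl⟩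
    · rintro _ ⟨w, rfl⟩
      exact Subgroup.subset_closure ⟨0, 0, w, rfl⟩

theorem V_le_K1 (ε : ℕ) : Vgrp K ≤ K1grp K ε := le_sup_left
theorem M_le_K1 (ε : ℕ) : Mgrp K ε ≤ K1grp K ε := le_sup_right
theorem C_le_K1 (ε : ℕ) : Cgrp K ≤ K1grp K ε :=
  (le_sup_left.trans le_sup_left).trans (M_le_K1 ε)
theorem D_le_K1 (ε : ℕ) : Dgrp K ≤ K1grp K ε :=
  (le_sup_right.trans le_sup_left).trans (M_le_K1 ε)
theorem T_le_K1 (ε : ℕ) : Tgrp K ε ≤ K1grp K ε := le_sup_right.trans (M_le_K1 ε)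
theorem T_le_K2 (ε : ℕ) : Tgrp K ε ≤ K2grp K ε := le_sup_right
theorem E_le_K2 (ε : ℕ) : Egrp K ε ≤ K2grp K ε := le_sup_right.trans le_sup_left
theorem C_le_K2 (ε : ℕ) : Cgrp K ≤ K2grp K ε :=
  (le_sup_right.trans le_sup_left).trans le_sup_left
theorem V_le_K2 (ε : ℕ) : Vgrp K ≤ K2grp K ε :=
  (le_sup_left.trans le_sup_left).trans le_sup_left

theorem K1_le {ε : ℕ} {H : Subgroup (Perm (K × K × K))} (hV : ∀ u v, alphaPerm u v 0 ∈ H)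
    (hC : ∀ e, gammaPerm e ∈ H) (hD : deltaPerm K ∈ H) (hT : ∀ m, betaPerm ε m m⁻¹ ∈ H) :
    K1grp K ε ≤ H := by
  refine sup_le ((Subgroup.closure_le _).2 ?_) (sup_le (sup_le ((Subgroup.closure_le _).2 ?_)
    ((Subgroup.closure_le _).2 ?_)) ((Subgroup.closure_le _).2 ?_))
  · rintro _ ⟨u, v, rfl⟩; exact hV u v
  · rintro _ ⟨e, rfl⟩; exact hC e
  · rintro _ rfl; exact hD
  · rintro _ ⟨m, rfl⟩; exact hT m

theorem K2_le {ε : ℕ} {H : Subgroup (Perm (K × K × K))} (hV : ∀ u v, alphaPerm u v 0 ∈ H)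
    (hC : ∀ e, gammaPerm e ∈ H) (hE : ∀ d, tauPerm ε d ∈ H) (hT : ∀ m, betaPerm ε m m⁻¹ ∈ H) :
    K2grp K ε ≤ H := by
  refine sup_le (sup_le (sup_le ((Subgroup.closure_le _).2 ?_) ((Subgroup.closure_le _).2 ?_))
    ((Subgroup.closure_le _).2 ?_)) ((Subgroup.closure_le _).2 ?_)
  · rintro _ ⟨u, v, rfl⟩; exact hV u v
  · rintro _ ⟨e, rfl⟩; exact hC e
  · rintro _ ⟨d, rfl⟩; exact hE d
  · rintro _ ⟨m, rfl⟩; exact hT m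

theorem conj_mem {G : Type*} [Group G] {N : Subgroup G} {g x y : G} (hy : y ∈ N)
    (e : g * x = y * g) : x ∈ N.comap (MulAut.conj g).toMonoidHom := by
  show g * x * g⁻¹ ∈ N
  rw [e]; simpa using hy

section fin
variable [Fintype K] [CharP K 3]

theorem be_norm_K1 (ε : ℕ) (l m : Kˣ) :
    betaPerm ε l m ∈ Subgroup.normalizer (K1grp K ε : Set (Perm (K × K × K))) := by
  apply mem_normalizer_of_le
  refine K1_le (fun u v => ?_) (fun e => ?_) ?_ (fun t => ?_)
  · exact conj_mem (V_le_K1 ε (al_mem_V _ _)) (by rw [be_al, mul_zero])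
  · exact conj_mem (C_le_K1 ε (ga_mem _)) (be_ga ..)
  · exact conj_mem (mul_mem (D_le_K1 ε de_mem) (T_le_K1 ε (be_mem_T _ _))) (be_de ..)
  · exact conj_mem (T_le_K1 ε (be_mem_T _ _)) (be_be ..)

theorem si_norm_K1 (ε : ℕ) :
    sigmaPerm K ∈ Subgroup.normalizer (K1grp K ε : Set (Perm (K × K × K))) := by
  apply mem_normalizer_of_le
  refine K1_le (fun u v => ?_) (fun e => ?_) ?_ (fun t => ?_)
  · exact conj_mem (V_le_K1 ε (al_mem_V _ _)) (by rw [si_al, zero_pow (by norm_num)])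
  · exact conj_mem (C_le_K1 ε (ga_mem _)) (si_ga ..)
  · exact conj_mem (D_le_K1 ε de_mem) si_de
  · exact conj_mem (T_le_K1 ε (be_mem_T _ (t ^ 3))) (by rw [si_be, inv_pow])

theorem be_norm_K2 (ε : ℕ) (hq : ∀ x : K, x ^ (3 * ε) = x) (l m : Kˣ) :
    betaPerm ε l m ∈ Subgroup.normalizer (K2grp K ε : Set (Perm (K × K × K))) := by
  apply mem_normalizer_of_le
  refine K2_le (fun u v => ?_) (fun e => ?_) (fun d => ?_) (fun t => ?_)
  · exact conj_mem (V_le_K2 ε (al_mem_V _ _)) (by rw [be_al, mul_zero])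
  · exact conj_mem (C_le_K2 ε (ga_mem _)) (be_ga ..)
  · exact conj_mem (E_le_K2 ε (ta_mem _ _)) (be_ta ε hq ..)
  · exact conj_mem (T_le_K2 ε (be_mem_T _ _)) (be_be ..)

theorem si_norm_K2 (ε : ℕ) :
    sigmaPerm K ∈ Subgroup.normalizer (K2grp K ε : Set (Perm (K × K × K))) := by
  apply mem_normalizer_of_le
  refine K2_le (fun u v => ?_) (fun e => ?_) (fun d => ?_) (fun t => ?_)
  · exact conj_mem (V_le_K2 ε (al_mem_V _ _)) (by rw [si_al, zero_pow (by norm_num)])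
  · exact conj_mem (C_le_K2 ε (ga_mem _)) (si_ga ..)
  · exact conj_mem (E_le_K2 ε (ta_mem _ _)) (si_ta ..)
  · exact conj_mem (T_le_K2 ε (be_mem_T _ (t ^ 3))) (by rw [si_be, inv_pow])

theorem be_norm_F (ε : ℕ) (l m : Kˣ) :
    betaPerm ε l m ∈ Subgroup.normalizer (Fgrp K : Set (Perm (K × K × K))) := by
  apply mem_normalizer_of_le
  refine (Subgroup.closure_le _).2 ?_
  rintro _ ⟨w, rfl⟩
  exact conj_mem (al_mem_F _) (by rw [be_al, mul_zero, mul_zero])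

theorem si_norm_F :
    sigmaPerm K ∈ Subgroup.normalizer (Fgrp K : Set (Perm (K × K × K))) := by
  apply mem_normalizer_of_le
  refine (Subgroup.closure_le _).2 ?_
  rintro _ ⟨w, rfl⟩
  exact conj_mem (al_mem_F _) (by rw [si_al, zero_pow (by norm_num)])

theorem F_norm_K2 (ε : ℕ) :
    Fgrp K ≤ Subgroup.normalizer (K2grp K ε : Set (Perm (K × K × K))) := by
  refine (Subgroup.closure_le _).2 ?_
  rintro _ ⟨w, rfl⟩
  apply mem_normalizer_of_le
  refine K2_le (fun u v => ?_) (fun e => ?_) (fun d => ?_) (fun t => ?_)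
  · exact conj_mem (V_le_K2 ε (al_mem_V _ _)) (al_al ..)
  · exact conj_mem (C_le_K2 ε (ga_mem _)) (al_ga ..)
  · exact conj_mem (mul_mem (V_le_K2 ε (al_mem_V _ _)) (E_le_K2 ε (ta_mem _ _))) (al_ta ..)
  · exact conj_mem (T_le_K2 ε (be_mem_T _ _)) (al_be ..)

theorem F_norm_K1 (ε : ℕ) :
    Fgrp K ≤ Subgroup.normalizer (K1grp K ε : Set (Perm (K × K × K))) := by
  refine (Subgroup.closure_le _).2 ?_
  rintro _ ⟨w, rfl⟩
  apply mem_normalizer_of_le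
  refine K1_le (fun u v => ?_) (fun e => ?_) ?_ (fun t => ?_)
  · exact conj_mem (V_le_K1 ε (al_mem_V _ _)) (al_al ..)
  · exact conj_mem (C_le_K1 ε (ga_mem _)) (al_ga ..)
  · exact conj_mem (D_le_K1 ε de_mem) (al_de ..)
  · exact conj_mem (T_le_K1 ε (be_mem_T _ _)) (al_be ..)

theorem SSig_le {ε : ℕ} {H : Subgroup (Perm (K × K × K))} (hS : ∀ m, betaPerm ε (m ^ 2) m ∈ H)
    (hs : sigmaPerm K ∈ H) : Sgrp K ε ⊔ Siggrp K ≤ H := by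
  refine sup_le ((Subgroup.closure_le _).2 ?_) ((Subgroup.closure_le _).2 ?_)
  · rintro _ ⟨m, rfl⟩; exact hS m
  · rintro _ rfl; exact hs

/-- affine determinant one shape -/
def shape1 (K : Type*) [Field K] [Fintype K] : Subgroup (Perm (K × K × K)) :=
  finSub (fun g => ∃ m n p s u v w : K, m * s - n * p = 1 ∧
    ∀ a b c, g (a, b, c) = (m * a + n * b + u, p * a + s * b + v, c + w))
  ⟨1, 0, 0, 1, 0, 0, 0, by simp, by simp⟩
  (by
    rintro g h ⟨m, n, p, s, u, v, w, hd, hg⟩ ⟨m', n', p', s', u', v', w', hd', hh⟩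
    refine ⟨m * m' + n * p', m * n' + n * s', p * m' + s * p', p * n' + s * s',
      m * u' + n * v' + u, p * u' + s * v' + v, w' + w, ?_, ?_⟩
    · linear_combination hd * (m' * s' - n' * p') + hd'
    · intro a b c
      rw [Perm.mul_apply, hh, hg]
      ext <;> simp <;> ring)

/-- triangular shape -/
def shape2 (K : Type*) [Field K] [Fintype K] : Subgroup (Perm (K × K × K)) :=
  finSub (fun g => ∃ l m p k e u v w : K, l * m = 1 ∧
    ∀ a b c, g (a, b, c) = (l * a + p * b ^ 2 + k * c + e * b + u, m * b + v, c + w))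
  ⟨1, 1, 0, 0, 0, 0, 0, 0, by simp, by simp⟩
  (by
    rintro g h ⟨l, m, p, k, e, u, v, w, hd, hg⟩ ⟨l', m', p', k', e', u', v', w', hd', hh⟩
    refine ⟨l * l', m * m', l * p' + p * m' ^ 2, l * k' + k, l * e' + 2 * p * m' * v' + e * m',
      l * u' + p * v' ^ 2 + k * w' + e * v' + u, m * v' + v, w' + w, ?_, ?_⟩
    · linear_combination hd * (l' * m') + hd'
    · intro a b c
      rw [Perm.mul_apply, hh, hg]
      ext <;> simp <;> ring)

/-- fixing the third coordinate -/
def shape0 (K : Type*) [Field K] [Fintype K] : Subgroup (Perm (K × K × K)) :=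
  finSub (fun g => ∀ x, (g x).2.2 = x.2.2) (by simp)
  (by intro g h hg hh x; rw [Perm.mul_apply, hg, hh])

/-- semilinear shape -/
def shape3 (K : Type*) [Field K] [Fintype K] [CharP K 3] : Subgroup (Perm (K × K × K)) :=
  finSub (fun g => ∃ m : Kˣ, ∃ i : ℕ, ∀ a b c,
    g (a, b, c) = ((m : K) ^ 2 * a ^ (3 ^ i), (m : K) * b ^ (3 ^ i), (m : K) ^ 2 * c ^ (3 ^ i)))
  ⟨1, 0, by simp⟩
  (by
    rintro g h ⟨m, i, hg⟩ ⟨m', i', hh⟩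
    refine ⟨m * m' ^ (3 ^ i), i' + i, fun a b c => ?_⟩
    rw [Perm.mul_apply, hh, hg]
    ext <;> simp only [Units.val_mul, Units.val_pow_eq_pow_val, mul_pow, pow_add, ← pow_mul] <;> ring)

theorem K1_shape0 (ε : ℕ) : K1grp K ε ≤ shape0 K := by
  refine K1_le (fun u v => ?_) (fun e => ?_) ?_ (fun t => ?_) <;> intro x <;>
    simp [alphaPerm, gammaPerm, deltaPerm, betaPerm]

theorem K2_shape0 (ε : ℕ) : K2grp K ε ≤ shape0 K := by
  refine K2_le (fun u v => ?_) (fun e => ?_) (fun d => ?_) (fun t => ?_) <;> intro x <;>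
    simp [alphaPerm, gammaPerm, tauPerm, betaPerm]

theorem FK1_shape1 (ε : ℕ) : Fgrp K ⊔ K1grp K ε ≤ shape1 K := by
  refine sup_le ((Subgroup.closure_le _).2 ?_)
    (K1_le (fun u v => ?_) (fun e => ?_) ?_ (fun t => ?_))
  · rintro _ ⟨w, rfl⟩
    exact ⟨1, 0, 0, 1, 0, 0, w, by simp, by simp [alphaPerm]⟩
  · exact ⟨1, 0, 0, 1, u, v, 0, by simp, by simp [alphaPerm]⟩
  · exact ⟨1, e, 0, 1, 0, 0, 0, by simp, by simp [gammaPerm]⟩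
  · exact ⟨0, 1, -1, 0, 0, 0, 0, by simp, by simp [deltaPerm]⟩
  · exact ⟨t, 0, 0, (t⁻¹ : Kˣ), 0, 0, 0, by simp, by simp [betaPerm]⟩

theorem K2F_shape2 (ε : ℕ) : K2grp K ε ⊔ Fgrp K ≤ shape2 K := by
  refine sup_le (K2_le (fun u v => ?_) (fun e => ?_) (fun d => ?_) (fun t => ?_))
    ((Subgroup.closure_le _).2 ?_)
  · exact ⟨1, 1, 0, 0, 0, u, v, 0, by simp, by simp [alphaPerm]⟩
  · exact ⟨1, 1, 0, 0, e, 0, 0, 0, by simp, by simp [gammaPerm]⟩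
  · exact ⟨1, 1, d, d ^ ε, 0, 0, 0, 0, by simp, by simp [tauPerm]⟩
  · exact ⟨t, (t⁻¹ : Kˣ), 0, 0, 0, 0, 0, 0, by simp, by simp [betaPerm]⟩
  · rintro _ ⟨w, rfl⟩
    exact ⟨1, 1, 0, 0, 0, 0, 0, w, by simp, by simp [alphaPerm]⟩

theorem SSig_shape3 (ε : ℕ) (hq : ∀ x : K, x ^ (3 * ε) = x) :
    Sgrp K ε ⊔ Siggrp K ≤ shape3 K := by
  refine SSig_le (fun m => ?_) ?_
  · refine ⟨m, 0, fun a b c => ?_⟩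
    have : ((((m ^ 2 * m) ^ (2 * ε) : Kˣ)) : K) = (m : K) ^ 2 := by
      push_cast
      rw [← pow_succ, ← pow_mul, show (2 + 1) * (2 * ε) = (3 * ε) * 2 by ring, pow_mul, hq]
    ext
    · simp [betaPerm]
    · simp [betaPerm]
    · show ((((m ^ 2 * m) ^ (2 * ε) : Kˣ)) : K) * c = _
      rw [this]; simp
  · exact ⟨1, 1, fun a b c => by simp [si_apply]⟩

theorem SSig_trans {ε : ℕ} (hq : ∀ x : K, x ^ (3 * ε) = x) {g : Perm (K × K × K)}
    (hg : g ∈ Sgrp K ε ⊔ Siggrp K) (w : K) (h : ∀ c, (g (0, 0, c)).2.2 = c + w) :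
    w = 0 ∧ ∃ m : K, m ^ 2 = 1 ∧ ∀ a b c, g (a, b, c) = (a, m * b, c) := by
  obtain ⟨m, i, hm⟩ := SSig_shape3 ε hq hg
  have h' : ∀ c : K, (m : K) ^ 2 * c ^ 3 ^ i = c + w := by
    intro c; rw [← h c, hm]
  have hw : w = 0 := by
    have := h' 0
    rw [zero_pow (by positivity)] at this
    simpa using this.symm
  subst hw
  have hm2 : (m : K) ^ 2 = 1 := by simpa using h' 1
  refine ⟨rfl, m, hm2, fun a b c => ?_⟩
  have h2 : ∀ c : K, c ^ 3 ^ i = c := by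
    intro c; have := h' c; rwa [hm2, one_mul, add_zero] at this
  rw [hm, hm2, h2, h2, h2, one_mul, one_mul]

theorem mem_F {g : Perm (K × K × K)} (hg : g ∈ Fgrp K) : ∃ w, g = alphaPerm 0 0 w := by
  have : Fgrp K ≤ finSub (fun g => ∃ w : K, g = alphaPerm 0 0 w)
      ⟨0, by ext x <;> simp [alphaPerm]⟩
      (by rintro _ _ ⟨w, rfl⟩ ⟨w', rfl⟩; exact ⟨w + w', by simp [al_mul]⟩) := by
    refine (Subgroup.closure_le _).2 ?_
    rintro _ ⟨w, rfl⟩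
    exact ⟨w, rfl⟩
  exact this hg

theorem F_shape0 : Fgrp K ⊓ shape0 K = ⊥ := by
  rw [eq_bot_iff]
  rintro g ⟨h1, h2⟩
  obtain ⟨w, rfl⟩ := mem_F h1
  have h : (alphaPerm 0 0 w (0, 0, 0) : K × K × K).2.2 = 0 := h2 _
  have : w = 0 := by simpa [alphaPerm] using h
  subst this
  rw [Subgroup.mem_bot]
  ext x <;> simp [alphaPerm]

theorem F_K1_comm (ε : ℕ) : ⁅Fgrp K, K1grp K ε⁆ = ⊥ := by
  rw [Subgroup.commutator_comm, Subgroup.commutator_eq_bot_iff_le_centralizer]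
  have key : ∀ x : Perm (K × K × K), (∀ w, alphaPerm 0 0 w * x = x * alphaPerm 0 0 w) →
      x ∈ Subgroup.centralizer (Fgrp K : Set (Perm (K × K × K))) := by
    intro x hx
    rw [Subgroup.mem_centralizer_iff]
    intro f hf
    obtain ⟨w, rfl⟩ := mem_F hf
    exact hx w
  refine K1_le (fun u v => ?_) (fun e => ?_) ?_ (fun t => ?_) <;> apply key <;> intro w
  · exact al_al ..
  · exact al_ga ..
  · exact al_de ..
  · exact al_be ..

theorem F_K2_comm (ε : ℕ) : ⁅Fgrp K, K2grp K ε⁆ = Zgrp K := by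
  apply le_antisymm
  · rw [Subgroup.commutator_le]
    intro f hf k hk
    obtain ⟨w, rfl⟩ := mem_F hf
    obtain ⟨l, m, p, j, e, u, v, w', -, hk'⟩ := K2F_shape2 ε (Subgroup.mem_sup_left hk)
    have : alphaPerm 0 0 w * k = alphaPerm (-(j * w)) 0 0 * (k * alphaPerm 0 0 w) := by
      apply Equiv.ext
      rintro ⟨a, b, c⟩
      simp only [Perm.mul_apply, hk']
      have h1 : alphaPerm 0 0 w (a, b, c) = (a, b, c + w) := by simp [alphaPerm]
      rw [h1]
      ext <;> simp [alphaPerm] <;> ring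
    rw [commutatorElement_def, this]
    have h2 : alphaPerm (-(j * w)) 0 0 * (k * alphaPerm 0 0 w) * (alphaPerm 0 0 w)⁻¹ * k⁻¹
      = alphaPerm (-(j * w)) 0 0 := by group
    rw [h2]
    exact al_mem_Z _
  · refine (Subgroup.closure_le _).2 ?_
    rintro _ ⟨u, rfl⟩
    have h := al_ta ε (-u) (1 : K)
    have h3 := Subgroup.commutator_mem_commutator (al_mem_F (-u)) (E_le_K2 ε (ta_mem ε (1 : K)))
    rw [commutatorElement_def, h] at h3
    simpa using h3

theorem FK1_inf (ε : ℕ) (hq : ∀ x : K, x ^ (3 * ε) = x) :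
    (Fgrp K ⊔ K1grp K ε) ⊓ (Sgrp K ε ⊔ Siggrp K) = ⊥ := by
  rw [eq_bot_iff]
  rintro g ⟨h1, h2⟩
  obtain ⟨m, n, p, s, u, v, w, hd, hg⟩ := FK1_shape1 ε h1
  obtain ⟨rfl, t, ht, hg'⟩ := SSig_trans hq h2 w (fun c => by rw [hg])
  have e0 := (hg 0 0 0).symm.trans (hg' 0 0 0)
  have e1 := (hg 1 0 0).symm.trans (hg' 1 0 0)
  have e2 := (hg 0 1 0).symm.trans (hg' 0 1 0)
  simp only [Prod.mk.injEq, mul_zero, mul_one, zero_add, add_zero, and_true] at e0 e1 e2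
  obtain ⟨rfl, rfl⟩ := e0
  simp only [add_zero] at e1 e2
  obtain ⟨rfl, rfl⟩ := e1
  obtain ⟨rfl, rfl⟩ := e2
  have : s = 1 := by linear_combination hd
  subst this
  rw [Subgroup.mem_bot]
  apply Equiv.ext
  rintro ⟨a, b, c⟩
  rw [hg']; simp

theorem K2F_inf (ε : ℕ) (hq : ∀ x : K, x ^ (3 * ε) = x) :
    (K2grp K ε ⊔ Fgrp K) ⊓ (Sgrp K ε ⊔ Siggrp K) = ⊥ := by
  rw [eq_bot_iff]
  rintro g ⟨h1, h2⟩
  obtain ⟨l, m, p, k, e, u, v, w, hd, hg⟩ := K2F_shape2 ε h1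
  obtain ⟨rfl, t, ht, hg'⟩ := SSig_trans hq h2 w (fun c => by rw [hg])
  have e0 := (hg 0 0 0).symm.trans (hg' 0 0 0)
  have e1 := (hg 1 0 0).symm.trans (hg' 1 0 0)
  have e2 := (hg 0 1 0).symm.trans (hg' 0 1 0)
  simp only [Prod.mk.injEq, mul_zero, mul_one, zero_add, add_zero, and_true, ne_eq, OfNat.ofNat_ne_zero,
    not_false_eq_true, zero_pow, one_pow] at e0 e1 e2
  obtain ⟨rfl, rfl⟩ := e0
  simp only [add_zero] at e1 e2
  have hl : l = 1 := e1.1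
  have hm : m = t := e2.2
  subst hl
  have : t = 1 := by rw [← hm]; linear_combination hd
  subst this
  rw [Subgroup.mem_bot]
  apply Equiv.ext
  rintro ⟨a, b, c⟩
  rw [hg']; simp

theorem K1_inf_G2 (ε : ℕ) (hq : ∀ x : K, x ^ (3 * ε) = x) {g s f k : Perm (K × K × K)}
    (hg : g ∈ K1grp K ε) (hs : s ∈ Sgrp K ε ⊔ Siggrp K) (hf : f ∈ Fgrp K) (hk : k ∈ K2grp K ε)
    (e : g = s * f * k) : g ∈ K2grp K ε := by
  obtain ⟨w, rfl⟩ := mem_F hf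
  have hk0 : ∀ x, (k x).2.2 = x.2.2 := K2_shape0 ε hk
  have hki0 : ∀ x, (k⁻¹ x).2.2 = x.2.2 := K2_shape0 ε (inv_mem hk)
  have hg0 : ∀ x, (g x).2.2 = x.2.2 := K1_shape0 ε hg
  have es : s = g * k⁻¹ * (alphaPerm 0 0 w)⁻¹ := by rw [e]; group
  have hai : (alphaPerm 0 0 w)⁻¹ = alphaPerm 0 0 (-w) := by
    rw [inv_eq_iff_mul_eq_one, al_mul]; ext x <;> simp [alphaPerm]
  obtain ⟨hw, t, ht, hs'⟩ := SSig_trans hq hs (-w) (fun c => by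
    rw [es, Perm.mul_apply, Perm.mul_apply, hg0, hki0, hai]; simp [alphaPerm])
  have hw : w = 0 := by simpa using hw
  subst hw
  have ha : alphaPerm 0 0 (0 : K) = 1 := by ext x <;> simp [alphaPerm]
  rw [ha, mul_one] at e
  obtain ⟨l, m, p, j, e', u, v, w, hd, hk'⟩ := K2F_shape2 ε (Subgroup.mem_sup_left hk)
  obtain ⟨m1, n1, p1, s1, u1, v1, w1, hd1, hg1⟩ := FK1_shape1 ε (Subgroup.mem_sup_right hg)
  have hc : ∀ a b c, (m1 * a + n1 * b + u1, p1 * a + s1 * b + v1, c + w1) =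
      (l * a + p * b ^ 2 + j * c + e' * b + u, t * (m * b + v), c + w) := by
    intro a b c
    rw [← hg1, e, Perm.mul_apply, hk', hs']
  have e0 := hc 0 0 0
  have e1 := hc 1 0 0
  have e2 := hc 0 1 0
  simp only [Prod.mk.injEq, mul_zero, mul_one, zero_add, add_zero, ne_eq, OfNat.ofNat_ne_zero,
    not_false_eq_true, zero_pow, one_pow] at e0 e1 e2
  obtain ⟨x1, x2, x3⟩ := e0
  obtain ⟨y1, y2, -⟩ := e1
  obtain ⟨z1, z2, -⟩ := e2
  have hm1 : m1 = l := by linear_combination y1 - x1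
  have hp1 : p1 = 0 := by linear_combination y2 - x2
  have hs1 : s1 = t * m := by linear_combination z2 - x2
  have ht1 : t = 1 := by
    rw [hm1, hp1, hs1] at hd1
    linear_combination hd1 - t * hd
  have : s = 1 := by
    apply Equiv.ext
    rintro ⟨a, b, c⟩
    rw [hs', ht1]; simp
  rw [e, this, one_mul]; exact hk

end fin

end helpers

/-- Lemma 3.3: structure of `G₁`, `G₂`, `G₁ ∩ G₂` and `G = ⟨G₁, G₂⟩` in terms of
`K₁`, `K₂`, `K = ⟨K₁,K₂⟩`, `F` and `SΣ = ⟨S,Σ⟩`.  (The paper's product `f·k·s`, composed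
left to right, is `s * k * f` in Lean.) -/
theorem stmt16 (r : ℕ) (hr : 1 ≤ r) (K : Type*) [Field K] [Fintype K] [CharP K 3]
    (hcard : Fintype.card K = 3 ^ r) (ε : ℕ) (hε : ε = 3 ^ (r - 1)) :
    (G1grp K ε = Fgrp K ⊔ K1grp K ε ⊔ (Sgrp K ε ⊔ Siggrp K)
      ∧ (∀ g ∈ G1grp K ε, ∃ f ∈ Fgrp K, ∃ k ∈ K1grp K ε, ∃ s ∈ Sgrp K ε ⊔ Siggrp K,
          g = s * k * f)
      ∧ ⁅Fgrp K, K1grp K ε⁆ = ⊥ ∧ Fgrp K ⊓ K1grp K ε = ⊥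
      ∧ (Fgrp K ⊔ K1grp K ε) ⊓ (Sgrp K ε ⊔ Siggrp K) = ⊥)
    ∧ (G2grp K ε = K2grp K ε ⊔ Fgrp K ⊔ (Sgrp K ε ⊔ Siggrp K)
      ∧ (∀ g ∈ G2grp K ε, ∃ k ∈ K2grp K ε, ∃ f ∈ Fgrp K, ∃ s ∈ Sgrp K ε ⊔ Siggrp K,
          g = s * f * k)
      ∧ ⁅Fgrp K, K2grp K ε⁆ = Zgrp K ∧ Fgrp K ⊓ K2grp K ε = ⊥
      ∧ (K2grp K ε ⊔ Fgrp K) ⊓ (Sgrp K ε ⊔ Siggrp K) = ⊥)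
    ∧ G1grp K ε ⊓ G2grp K ε = Fgrp K ⊔ (K1grp K ε ⊓ K2grp K ε) ⊔ (Sgrp K ε ⊔ Siggrp K)
    ∧ ((∀ g ∈ G1grp K ε ⊔ G2grp K ε, ∀ k ∈ K1grp K ε ⊔ K2grp K ε,
        g * k * g⁻¹ ∈ K1grp K ε ⊔ K2grp K ε)
      ∧ G1grp K ε ⊔ G2grp K ε = (K1grp K ε ⊔ K2grp K ε) ⊔ Fgrp K ⊔ (Sgrp K ε ⊔ Siggrp K)
      ∧ (∀ g ∈ G1grp K ε ⊔ G2grp K ε, ∃ k ∈ K1grp K ε ⊔ K2grp K ε, ∃ f ∈ Fgrp K,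
          ∃ s ∈ Sgrp K ε ⊔ Siggrp K, g = s * f * k)) := by
  have hq : ∀ x : K, x ^ (3 * ε) = x := by
    intro x
    have : 3 * ε = Fintype.card K := by
      rw [hcard, hε, ← pow_succ', Nat.sub_add_cancel hr]
    rw [this, FiniteField.pow_card]
  have nF : Sgrp K ε ⊔ Siggrp K ≤ Subgroup.normalizer (Fgrp K : Set (Perm (K × K × K))) :=
    SSig_le (fun m => be_norm_F ε _ _) si_norm_F
  have n1 : Sgrp K ε ⊔ Siggrp K ≤ Subgroup.normalizer (K1grp K ε : Set (Perm (K × K × K))) :=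
    SSig_le (fun m => be_norm_K1 ε _ _) (si_norm_K1 ε)
  have n2 : Sgrp K ε ⊔ Siggrp K ≤ Subgroup.normalizer (K2grp K ε : Set (Perm (K × K × K))) :=
    SSig_le (fun m => be_norm_K2 ε hq _ _) (si_norm_K2 ε)
  have n12 := norm_sup n1 n2
  have f1 := F_norm_K1 (K := K) ε
  have f2 := F_norm_K2 (K := K) ε
  have f12 := norm_sup f1 f2
  have hG1 : G1grp K ε = Fgrp K ⊔ K1grp K ε ⊔ (Sgrp K ε ⊔ Siggrp K) := by
    unfold G1grp K1grp
    rw [A_eq]; ac_rfl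
  have hG2 : G2grp K ε = K2grp K ε ⊔ Fgrp K ⊔ (Sgrp K ε ⊔ Siggrp K) := by
    unfold G2grp K2grp QgrpBig
    rw [A_eq]; ac_rfl
  have hG : G1grp K ε ⊔ G2grp K ε =
      (K1grp K ε ⊔ K2grp K ε) ⊔ Fgrp K ⊔ (Sgrp K ε ⊔ Siggrp K) := by
    rw [hG1, hG2, ← sup_sup_distrib_right]
    congr 1
    rw [sup_comm (Fgrp K), ← sup_sup_distrib_right]
  have dec : ∀ N : Subgroup (Perm (K × K × K)),
      Sgrp K ε ⊔ Siggrp K ≤ Subgroup.normalizer (N : Set (Perm (K × K × K))) →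
      Fgrp K ≤ Subgroup.normalizer (N : Set (Perm (K × K × K))) →
      ∀ g ∈ N ⊔ Fgrp K ⊔ (Sgrp K ε ⊔ Siggrp K), ∃ k ∈ N, ∃ f ∈ Fgrp K,
        ∃ s ∈ Sgrp K ε ⊔ Siggrp K, g = s * f * k := by
    intro N hN hF g hg
    rw [sup_comm] at hg
    obtain ⟨s, hs, y, hy, e⟩ := exists_of_norm (norm_sup hN nF) hg
    rw [sup_comm] at hy
    obtain ⟨f, hf, k, hk, e'⟩ := exists_of_norm hF hy
    exact ⟨k, hk, f, hf, s, hs, by rw [e, e', mul_assoc]⟩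
  have dec1 : ∀ g ∈ G1grp K ε, ∃ f ∈ Fgrp K, ∃ k ∈ K1grp K ε, ∃ s ∈ Sgrp K ε ⊔ Siggrp K,
          g = s * k * f := by
    intro g hg
    rw [hG1, sup_comm (Fgrp K)] at hg
    obtain ⟨k, hk, f, hf, s, hs, e⟩ := dec _ n1 f1 g hg
    refine ⟨f, hf, k, hk, s, hs, ?_⟩
    have hc : f ∈ Subgroup.centralizer (K1grp K ε : Set (Perm (K × K × K))) :=
      Subgroup.commutator_eq_bot_iff_le_centralizer.1 (F_K1_comm ε) hf
    rw [e, mul_assoc, mul_assoc, Subgroup.mem_centralizer_iff.1 hc k hk]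
  have dec2 : ∀ g ∈ G2grp K ε, ∃ k ∈ K2grp K ε, ∃ f ∈ Fgrp K, ∃ s ∈ Sgrp K ε ⊔ Siggrp K,
          g = s * f * k := by
    intro g hg
    rw [hG2] at hg
    exact dec _ n2 f2 g hg
  refine ⟨⟨hG1, dec1, F_K1_comm ε, ?_, FK1_inf ε hq⟩,
    ⟨hG2, dec2, F_K2_comm ε, ?_, K2F_inf ε hq⟩, ?_, ?_, hG, ?_⟩
  · exact eq_bot_iff.2 ((inf_le_inf_left _ (K1_shape0 ε)).trans F_shape0.le)
  · exact eq_bot_iff.2 ((inf_le_inf_left _ (K2_shape0 ε)).trans F_shape0.le)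
  · apply le_antisymm
    · rintro g ⟨h1, h2⟩
      obtain ⟨f, hf, k, hk, s, hs, e⟩ := dec1 g h1
      have hf2 : f ∈ G2grp K ε := by
        rw [hG2]; exact Subgroup.mem_sup_left (Subgroup.mem_sup_right hf)
      have hs2 : s ∈ G2grp K ε := by
        rw [hG2]; exact Subgroup.mem_sup_right hs
      have hk2 : k ∈ G2grp K ε := by
        have : k = s⁻¹ * g * f⁻¹ := by rw [e]; group
        rw [this]
        exact mul_mem (mul_mem (inv_mem hs2) h2) (inv_mem hf2)
      obtain ⟨k', hk', f', hf', s', hs', e'⟩ := dec2 k hk2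
      have hkk := K1_inf_G2 ε hq hk hs' hf' hk' e'
      rw [e]
      exact mul_mem (mul_mem (Subgroup.mem_sup_right hs)
        (Subgroup.mem_sup_left (Subgroup.mem_sup_right ⟨hk, hkk⟩)))
        (Subgroup.mem_sup_left (Subgroup.mem_sup_left hf))
    · rw [hG1, hG2]
      refine le_inf ?_ ?_
      · exact sup_le_sup_right (sup_le_sup_left inf_le_left _) _
      · rw [sup_comm (K2grp K ε)]
        exact sup_le_sup_right (sup_le_sup_left inf_le_right _) _
  · have : G1grp K ε ⊔ G2grp K ε ≤
        Subgroup.normalizer ((K1grp K ε ⊔ K2grp K ε : Subgroup _) : Set (Perm (K × K × K))) := by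
      rw [hG]
      exact sup_le (sup_le Subgroup.le_normalizer f12) n12
    intro g hg k hk
    exact (Subgroup.mem_normalizer_iff.1 (this hg) k).1 hk
  · intro g hg
    rw [hG] at hg
    exact dec _ n12 f12 g hg
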